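/- arXiv:1307.5554 — 4 statements merged into one kernel-verified Lean document; each statement's English description precedes it below -/
import Mathlib

section
/- For all integers n ≥ 1 and k ≥ 1, the n×n complex matrix T indexed by a, b ∈ ℤ/n with entries T_{a,b} = Li_{k+1}(ζ_n^{ab}) is invertible. -/
/-- The polylogarithm series: `Li k z = ∑_{m=1}^∞ z^m / m^k`. -/
noncomputable def Li (k : ℕ) (z : ℂ) : ℂ := ∑' m : ℕ, z ^ (m + 1) / ((m : ℂ) + 1) ^ k

/-- The standard primitive `n`-th root of unity `ζ_n = exp(2πi/n)`. -/
noncomputable def zetaN (n : ℕ) : ℂ := Complex.exp (2 * Real.pi * Complex.I / n)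

/-- On a finite semiring, the operator `f ↦ (a ↦ ∑_{m ≥ 1} f (a m) / m ^ s)` with `s ≥ 2` has
trivial kernel, because `∑_{m ≥ 2} 1 / m ^ 2 < 1`. -/
theorem eq_zero_of_tsum_dilation_eq_zero {R : Type*} [Semiring R] [Finite R] {s : ℕ}
    (hs : 2 ≤ s) (f : R → ℂ)
    (hf : ∀ a, ∑' m : ℕ, f (a * ((m + 1 : ℕ) : R)) / ((m : ℂ) + 1) ^ s = 0) : f = 0 := by
  obtain ⟨a, ha⟩ := Finite.exists_max fun a => ‖f a‖
  have hzeta : HasSum (fun m : ℕ => 1 / ((m + 1 : ℕ) : ℝ) ^ 2) (Real.pi ^ 2 / 6) := by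
    simpa using (hasSum_nat_add_iff' 1).mpr hasSum_zeta_two
  have hbound (m : ℕ) : ‖f (a * ((m + 1 : ℕ) : R)) / ((m : ℂ) + 1) ^ s‖ ≤
      ‖f a‖ * (1 / ((m + 1 : ℕ) : ℝ) ^ 2) := by
    have hnorm : ‖(m : ℂ) + 1‖ = ((m + 1 : ℕ) : ℝ) := by
      rw [← Nat.cast_succ, Complex.norm_natCast]
    rw [norm_div, norm_pow, hnorm, div_eq_mul_one_div]
    have hm : (1 : ℝ) ≤ ((m + 1 : ℕ) : ℝ) := by exact_mod_cast Nat.le_add_left 1 m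
    gcongr
    exact ha _
  have hsummable : Summable fun m : ℕ => f (a * ((m + 1 : ℕ) : R)) / ((m : ℂ) + 1) ^ s :=
    .of_norm_bounded (hzeta.mul_left ‖f a‖).summable hbound
  have hsplit := hsummable.tsum_eq_zero_add
  rw [hf a] at hsplit
  have htail := tsum_of_norm_bounded
    ((hasSum_nat_add_iff' 1).mpr (hzeta.mul_left ‖f a‖)) fun m => hbound (m + 1)
  rw [eq_neg_of_add_eq_zero_right hsplit.symm, norm_neg] at htail
  simp only [Nat.cast_zero, zero_add, Nat.cast_one, mul_one, one_pow, div_one,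
    Finset.sum_range_one] at htail
  have hpi : Real.pi ^ 2 < 12 := by nlinarith [Real.pi_lt_d2, Real.pi_pos]
  have hfa : ‖f a‖ ≤ 0 := by nlinarith [norm_nonneg (f a)]
  exact funext fun b => norm_le_zero_iff.mp ((ha b).trans hfa)

theorem zetaN_pow_val (n : ℕ) [NeZero n] (x : ZMod n) :
    zetaN n ^ x.val = ZMod.stdAddChar x := by
  rw [ZMod.stdAddChar_apply, ZMod.toCircle_apply, zetaN, ← Complex.exp_nat_mul]
  congr 1
  ring

theorem summable_Li {s : ℕ} (hs : 2 ≤ s) {z : ℂ} (hz : ‖z‖ ≤ 1) :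
    Summable fun m : ℕ => z ^ (m + 1) / ((m : ℂ) + 1) ^ s := by
  refine .of_norm_bounded
    ((summable_nat_add_iff 1).mpr (Real.summable_one_div_nat_pow.mpr hs)) fun m => ?_
  rw [norm_div, norm_pow, norm_pow, ← Nat.cast_succ, Complex.norm_natCast]
  gcongr
  exact pow_le_one₀ (norm_nonneg z) hz

theorem sum_Li_stdAddChar_mul {n s : ℕ} [NeZero n] (hs : 2 ≤ s) (v : ZMod n → ℂ) (a : ZMod n) :
    ∑ b, Li s (ZMod.stdAddChar (a * b)) * v b =
      ∑' m : ℕ, ZMod.dft v (-(a * ((m + 1 : ℕ) : ZMod n))) / ((m : ℂ) + 1) ^ s := by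
  simp only [Li, ← tsum_mul_right]
  rw [← Summable.tsum_finsetSum fun b _ =>
    (summable_Li hs (AddChar.norm_apply _ _).le).mul_right (v b)]
  refine tsum_congr fun m => ?_
  rw [ZMod.dft_apply, Finset.sum_div]
  refine Finset.sum_congr rfl fun b _ => ?_
  rw [← AddChar.map_nsmul_eq_pow, nsmul_eq_mul, smul_eq_mul,
    show -(b * -(a * ((m + 1 : ℕ) : ZMod n))) = ((m + 1 : ℕ) : ZMod n) * (a * b) by ring]
  ring

/-- For all `n ≥ 1` and `k ≥ 1`, the `n × n` complex matrix indexed by `a, b ∈ ℤ/n`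
with entries `T_{a,b} = Li_{k+1}(ζ_n^{ab})` is invertible. -/
theorem stmt0 (n k : ℕ) [NeZero n] (hk : 1 ≤ k) :
    IsUnit (Matrix.of (fun a b : ZMod n =>
      Li (k + 1) (zetaN n ^ ((a * b : ZMod n).val)))) := by
  have hs : 2 ≤ k + 1 := Nat.succ_le_succ hk
  simp only [zetaN_pow_val]
  rw [← Matrix.mulVec_injective_iff_isUnit, ← Matrix.coe_mulVecLin, injective_iff_map_eq_zero]
  intro v hv
  have hzero := eq_zero_of_tsum_dilation_eq_zero hs (fun c => ZMod.dft v (-c)) fun a =>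
    (sum_Li_stdAddChar_mul hs v a).symm.trans (congrFun hv a)
  refine ZMod.dft.map_eq_zero_iff.mp (funext fun c => ?_)
  simpa using congrFun hzero (-c)
end

section
/- For all integers n ≥ 1 and k ≥ 1, the φ(n)×φ(n) complex matrix indexed by a, b ∈ (ℤ/n)^* (the units of ℤ/n) with entries Li_{k+1}(ζ_n^{ab}) is invertible. -/
open Complex Filter Topology HurwitzZeta
open scoped ZMod

/-- The scalar `(2π)^(-s) Γ(s) (e^{πis/2} + ε e^{-πis/2})` of the functional equation. -/
noncomputable def archimedeanFactor (ε s : ℂ) : ℂ :=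
  (2 * Real.pi) ^ (-s) * Gamma s *
    (cexp (Real.pi * I * s / 2) + ε * cexp (-Real.pi * I * s / 2))

lemma archimedeanFactor_ne_zero {ε : ℂ} (hε : ε ^ 2 = 1) {r : ℝ} (hr : 0 < r)
    (hint : ∀ m : ℤ, r ≠ m) : archimedeanFactor ε r ≠ 0 := by
  have hpi : (2 * Real.pi : ℂ) ≠ 0 := by simp [Real.pi_ne_zero]
  refine mul_ne_zero (mul_ne_zero (by simp [cpow_eq_zero_iff, Real.pi_ne_zero])
    (Gamma_ne_zero_of_re_pos (by simpa using hr))) fun h ↦ ?_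
  have hsq : cexp (2 * Real.pi * I * r) = 1 := by
    have h₁ : cexp (Real.pi * I * r / 2) * cexp (-Real.pi * I * r / 2) = 1 := by
      rw [← exp_add, ← exp_zero]; congr 1; ring
    have h₂ : cexp (2 * Real.pi * I * r) = cexp (Real.pi * I * r / 2) ^ 4 := by
      rw [← exp_nat_mul]; congr 1; push_cast; ring
    have h₃ : cexp (Real.pi * I * r / 2) ^ 2 = -ε := by
      linear_combination cexp (Real.pi * I * r / 2) * h - ε * h₁
    rw [h₂]
    linear_combination (cexp (Real.pi * I * r / 2) ^ 2 - ε) * h₃ + hε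
  obtain ⟨m, hm⟩ := exp_eq_one_iff.mp hsq
  refine hint m ?_
  have : (r : ℂ) = m := by
    have hpiI : (2 * Real.pi * I : ℂ) ≠ 0 := mul_ne_zero hpi I_ne_zero
    exact mul_left_cancel₀ hpiI (by linear_combination hm)
  exact_mod_cast this

/-- Functional equation of the `L`-function of a (not necessarily primitive) character. -/
lemma LFunction_one_sub_eq_archimedeanFactor_mul {N : ℕ} [NeZero N] (χ : DirichletCharacter ℂ N)
    {s : ℂ} (hs : 1 < s.re) :
    ZMod.LFunction χ (1 - s) =
      N ^ (s - 1) * archimedeanFactor (χ (-1)) s * ZMod.LFunction (𝓕 χ) s := by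
  have hneg : (fun x ↦ χ (-x)) = fun x ↦ χ (-1) * χ x := by
    ext x; rw [← map_mul, neg_one_mul]
  have hdft : ZMod.LFunction (𝓕 fun x ↦ χ (-x)) s = χ (-1) * ZMod.LFunction (𝓕 χ) s := by
    rw [hneg, ZMod.dft_const_mul]
    simp only [ZMod.LFunction, mul_assoc, ← Finset.mul_sum]
    ring
  rw [ZMod.LFunction_one_sub _ (fun n hn ↦ ?_) (.inr fun h ↦ ?_), hdft, archimedeanFactor]
  · ring
  · have : (0 : ℝ) ≤ n := n.cast_nonneg
    simp only [hn, neg_re, natCast_re] at hs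
    linarith
  · simp [h] at hs

lemma changeLevel_apply_neg_one {M N : ℕ} (hMN : M ∣ N) (χ : DirichletCharacter ℂ M) :
    DirichletCharacter.changeLevel hMN χ (-1) = χ (-1) := by
  simpa using DirichletCharacter.changeLevel_eq_cast_of_dvd' χ hMN (a := -1)
    (isCoprime_one_left.neg_left)

/-- Effect of a change of level on the `L`-function of the Fourier transform of a character. -/
lemma LFunction_dft_changeLevel {M N : ℕ} [NeZero M] [NeZero N] (hMN : M ∣ N)
    (χ : DirichletCharacter ℂ M) {r : ℝ} (hr : 1 < r) :
    (N : ℂ) ^ ((r : ℂ) - 1) * ZMod.LFunction (𝓕 (DirichletCharacter.changeLevel hMN χ)) r =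
      (M : ℂ) ^ ((r : ℂ) - 1) * ZMod.LFunction (𝓕 χ) r *
        ∏ p ∈ N.primeFactors, (1 - χ p * (p : ℂ) ^ ((r : ℂ) - 1)) := by
  have hgen : ∀ t : ℝ, 1 < t → (∀ m : ℤ, t ≠ m) →
      (N : ℂ) ^ ((t : ℂ) - 1) * ZMod.LFunction (𝓕 (DirichletCharacter.changeLevel hMN χ)) t =
      (M : ℂ) ^ ((t : ℂ) - 1) * ZMod.LFunction (𝓕 χ) t *
        ∏ p ∈ N.primeFactors, (1 - χ p * (p : ℂ) ^ ((t : ℂ) - 1)) := by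
    intro t ht hint
    have ht' : 1 < (t : ℂ).re := by simpa using ht
    have hA : archimedeanFactor (χ (-1)) t ≠ 0 :=
      archimedeanFactor_ne_zero (by rw [← map_pow]; simp) (by linarith) hint
    have h := DirichletCharacter.LFunction_changeLevel hMN χ (s := 1 - t)
      (.inr fun h ↦ by
        have : (t : ℂ) = 0 := by linear_combination -h
        rw [this] at ht'
        norm_num at ht')
    simp only [DirichletCharacter.LFunction, neg_sub] at h
    rw [LFunction_one_sub_eq_archimedeanFactor_mul _ ht',
      LFunction_one_sub_eq_archimedeanFactor_mul _ ht', changeLevel_apply_neg_one] at h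
    refine mul_left_cancel₀ hA ?_
    linear_combination h
  have hL {K : ℕ} [NeZero K] (Φ : ZMod K → ℂ) :
      ContinuousAt (fun t : ℝ ↦ ZMod.LFunction Φ t) r := by
    have h := (ZMod.differentiableAt_LFunction Φ r
      (.inl (by exact_mod_cast hr.ne'))).continuousAt
    exact ContinuousAt.comp (f := fun t : ℝ ↦ (t : ℂ)) h continuous_ofReal.continuousAt
  have hpow (K : ℕ) (hK : K ≠ 0) : ContinuousAt (fun t : ℝ ↦ (K : ℂ) ^ ((t : ℂ) - 1)) r := by
    have : NeZero K := ⟨hK⟩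
    fun_prop
  have hleft := ((hpow N (NeZero.ne N)).mul
    (hL (𝓕 (DirichletCharacter.changeLevel hMN χ)))).tendsto.mono_left
      (nhdsWithin_le_nhds (s := Set.Ioi r))
  have hprod : ContinuousAt
      (fun t : ℝ ↦ ∏ p ∈ N.primeFactors, (1 - χ p * (p : ℂ) ^ ((t : ℂ) - 1))) r :=
    tendsto_finsetProd _ fun p hp ↦
      (continuousAt_const.sub
        (continuousAt_const.mul (hpow p (Nat.prime_of_mem_primeFactors hp).ne_zero))).tendsto
  have hright := (((hpow M (NeZero.ne M)).mul (hL (𝓕 χ))).mul hprod).tendsto.mono_left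
    (nhdsWithin_le_nhds (s := Set.Ioi r))
  refine tendsto_nhds_unique (hleft.congr' ?_) hright
  filter_upwards [Ioo_mem_nhdsGT (Int.lt_floor_add_one r)] with t ht
  refine hgen t (hr.trans ht.1) fun m hm ↦ ?_
  have h₁ : ⌊r⌋ < m := by
    have := (Int.floor_le r).trans_lt ht.1
    rw [hm] at this
    exact_mod_cast this
  have h₂ : m < ⌊r⌋ + 1 := by
    have := ht.2
    rw [hm] at this
    exact_mod_cast this
  omega

lemma LFunction_dft_ne_zero_of_isPrimitive {N : ℕ} [NeZero N] {χ : DirichletCharacter ℂ N}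
    (hχ : χ.IsPrimitive) {s : ℂ} (hs : 1 < s.re) : ZMod.LFunction (𝓕 χ) s ≠ 0 := by
  have hdft : 𝓕 χ = fun k ↦ (gaussSum χ ZMod.stdAddChar * χ⁻¹ (-1)) * χ⁻¹ k := by
    ext k
    rw [hχ.fourierTransform_eq_inv_mul_gaussSum, ← neg_one_mul, map_mul]
    ring
  have hc : gaussSum χ ZMod.stdAddChar * χ⁻¹ (-1) ≠ 0 := by
    intro h
    have h0 : 𝓕 (χ : ZMod N → ℂ) = 0 := by
      rw [hdft, h]; ext; simp
    have h1 : (χ : ZMod N → ℂ) = 0 := ZMod.dft.map_eq_zero_iff.mp h0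
    simpa using congrFun h1 1
  have hL : ZMod.LFunction (𝓕 χ) s =
      gaussSum χ ZMod.stdAddChar * χ⁻¹ (-1) * DirichletCharacter.LFunction χ⁻¹ s := by
    rw [hdft]
    simp only [DirichletCharacter.LFunction, ZMod.LFunction, mul_assoc, ← Finset.mul_sum]
    ring
  rw [hL]
  exact mul_ne_zero hc (DirichletCharacter.LFunction_ne_zero_of_one_le_re _
    (.inr fun h ↦ by simp [h] at hs) hs.le)

lemma LFunction_dft_ne_zero {N : ℕ} [NeZero N] (χ : DirichletCharacter ℂ N) {r : ℝ}
    (hr : 1 < r) : ZMod.LFunction (𝓕 χ) r ≠ 0 := by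
  have : NeZero χ.conductor := ⟨χ.conductor_ne_zero⟩
  have h := LFunction_dft_changeLevel χ.conductor_dvd_level χ.primitiveCharacter hr
  rw [χ.changeLevel_primitiveCharacter] at h
  refine right_ne_zero_of_mul (h.trans_ne (mul_ne_zero (mul_ne_zero ?_ ?_) ?_))
  · simp [cpow_eq_zero_iff, NeZero.ne]
  · exact LFunction_dft_ne_zero_of_isPrimitive χ.primitiveCharacter_isPrimitive (by simpa using hr)
  · refine Finset.prod_ne_zero_iff.mpr fun p hp h0 ↦ ?_
    have hp := Nat.prime_of_mem_primeFactors hp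
    have hnorm : ‖(p : ℂ) ^ ((r : ℂ) - 1)‖ = (p : ℝ) ^ (r - 1) := by
      rw [norm_natCast_cpow_of_pos hp.pos]; simp
    have hgt : 1 < (p : ℝ) ^ (r - 1) :=
      Real.one_lt_rpow (by exact_mod_cast hp.one_lt) (by linarith)
    have h1 : χ.primitiveCharacter p * (p : ℂ) ^ ((r : ℂ) - 1) = 1 := (sub_eq_zero.mp h0).symm
    rcases eq_or_ne (χ.primitiveCharacter p) 0 with hz | hz
    · simp [hz] at h1
    · have hu : IsUnit ((p : ℕ) : ZMod χ.conductor) := by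
        by_contra hu
        exact hz (MulChar.map_nonunit _ hu)
      have hone : ‖χ.primitiveCharacter p‖ = 1 :=
        χ.primitiveCharacter.unit_norm_eq_one hu.unit
      have := congrArg norm h1
      rw [norm_mul, hone, hnorm, norm_one, one_mul] at this
      exact hgt.ne' this

lemma expZeta_toAddCircle_eq_Li {n : ℕ} [NeZero n] (j : ZMod n) {k : ℕ} (hk : 1 < k) :
    expZeta (ZMod.toAddCircle j) k = Li k (zetaN n ^ j.val) := by
  have hs : 1 < (k : ℂ).re := by simpa using hk
  rw [ZMod.toAddCircle_apply]
  have h := hasSum_expZeta_of_one_lt_re (j.val / n : ℝ) hs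
  rw [← h.tsum_eq, h.summable.tsum_eq_zero_add, Li]
  have hk0 : (0 : ℂ) ^ k = 0 := zero_pow (by omega)
  simp only [cpow_natCast, Nat.cast_zero, hk0, div_zero, zero_add]
  refine tsum_congr fun m ↦ ?_
  rw [zetaN, ← exp_nat_mul, ← exp_nat_mul]
  push_cast
  congr 2
  ring

lemma sum_char_mul_Li_ne_zero {n : ℕ} [NeZero n] (χ : DirichletCharacter ℂ n) {k : ℕ}
    (hk : 1 < k) : ∑ a : (ZMod n)ˣ, χ a * Li k (zetaN n ^ (a : ZMod n).val) ≠ 0 := by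
  have h := LFunction_dft_ne_zero χ (r := k) (by exact_mod_cast hk)
  rw [ofReal_natCast, ZMod.LFunction_dft _ (.inr (by exact_mod_cast hk.ne'))] at h
  have hneg : ∑ j : ZMod n, χ j * expZeta (ZMod.toAddCircle (-j)) k =
      χ (-1) * ∑ j : ZMod n, χ j * expZeta (ZMod.toAddCircle j) k := by
    rw [Finset.mul_sum]
    refine Fintype.sum_equiv (Equiv.neg _) _ _ fun j ↦ ?_
    rw [Equiv.neg_apply, ← mul_assoc, ← map_mul, neg_one_mul, neg_neg]
  rw [hneg] at h
  convert right_ne_zero_of_mul h using 1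
  simp only [expZeta_toAddCircle_eq_Li _ hk]
  refine Fintype.sum_of_injective (fun a : (ZMod n)ˣ ↦ (a : ZMod n)) Units.val_injective _ _
    (fun j hj ↦ ?_) fun _ ↦ rfl
  rw [MulChar.map_nonunit _ fun hu ↦ hj ⟨hu.unit, rfl⟩, zero_mul]

/-- A matrix `F (a * b)` indexed by `(ℤ/n)ˣ` is invertible if no character sum of `F` vanishes. -/
lemma isUnit_matrix_of_forall_sum_char_ne_zero {n : ℕ} [NeZero n] (F : (ZMod n)ˣ → ℂ)
    (hF : ∀ χ : DirichletCharacter ℂ n, ∑ a : (ZMod n)ˣ, χ a * F a ≠ 0) :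
    IsUnit (Matrix.of fun a b : (ZMod n)ˣ ↦ F (a * b)) := by
  rw [← Matrix.mulVec_injective_iff_isUnit, ← Matrix.coe_mulVecLin, injective_iff_map_eq_zero]
  intro v hv
  have hrow (a : (ZMod n)ˣ) : ∑ b, F (a * b) * v b = 0 := congrFun hv a
  have hchar (χ : DirichletCharacter ℂ n) : ∑ b : (ZMod n)ˣ, χ (b⁻¹ : (ZMod n)ˣ) * v b = 0 := by
    refine (mul_eq_zero.mp ?_).resolve_left (hF χ)
    calc (∑ a : (ZMod n)ˣ, χ a * F a) * ∑ b : (ZMod n)ˣ, χ (b⁻¹ : (ZMod n)ˣ) * v b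
        = ∑ b : (ZMod n)ˣ, ∑ a : (ZMod n)ˣ, χ a * (F (a * b) * v b) := by
          rw [Finset.mul_sum]
          refine Finset.sum_congr rfl fun b _ ↦ ?_
          rw [Finset.sum_mul]
          refine Fintype.sum_equiv (Equiv.mulRight b⁻¹) _ _ fun a ↦ ?_
          simp only [Equiv.coe_mulRight, Units.val_mul, map_mul, inv_mul_cancel_right]
          ring
      _ = ∑ a : (ZMod n)ˣ, χ a * ∑ b, F (a * b) * v b := by
          rw [Finset.sum_comm]
          simp only [Finset.mul_sum]
      _ = 0 := by simp [hrow]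
  ext c
  have hzero : ∑ b : (ZMod n)ˣ, (∑ χ : DirichletCharacter ℂ n,
      χ ((b : ZMod n)⁻¹) * χ c) * v b = 0 := by
    simp only [Finset.sum_mul]
    rw [Finset.sum_comm]
    refine Finset.sum_eq_zero fun χ _ ↦ ?_
    rw [← mul_zero (χ c), ← hchar χ, Finset.mul_sum]
    refine Finset.sum_congr rfl fun b _ ↦ ?_
    rw [ZMod.inv_coe_unit]
    ring
  simp only [DirichletCharacter.sum_char_inv_mul_char_eq ℂ (Units.isUnit _), Units.val_inj,
    ite_mul, zero_mul, Finset.sum_ite_eq', Finset.mem_univ, if_true] at hzero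
  exact (mul_eq_zero.mp hzero).resolve_left
    (by exact_mod_cast (Nat.totient_pos.mpr (NeZero.pos n)).ne')

/-- For all `n ≥ 1` and `k ≥ 1`, the `φ(n) × φ(n)` complex matrix indexed by
`a, b ∈ (ℤ/n)^*` with entries `Li_{k+1}(ζ_n^{ab})` is invertible. -/
theorem stmt1 (n k : ℕ) [NeZero n] (hk : 1 ≤ k) :
    IsUnit (Matrix.of (fun a b : (ZMod n)ˣ =>
      Li (k + 1) (zetaN n ^ (((a : ZMod n) * (b : ZMod n)).val)))) := by
  have h := isUnit_matrix_of_forall_sum_char_ne_zero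
    (fun a : (ZMod n)ˣ ↦ Li (k + 1) (zetaN n ^ (a : ZMod n).val))
    fun χ ↦ sum_char_mul_Li_ne_zero χ (by omega)
  simpa only [Units.val_mul] using h
end

section
/- For every integer n ≥ 1, every integer k ≥ 1, and every multiplicative character χ of ℤ/n, the number e_n(χ) = ∑_{a ∈ (ℤ/n)^*} Li_{k+1}(ζ_n^a) · conj(χ(a)) is nonzero. -/
open Complex Filter Topology
open scoped ZMod

/-- The polylogarithm at a power of `ζ_n` is a value of the exponential zeta function. -/
lemma Li_zetaN_pow_val (n k : ℕ) [NeZero n] (hk : 1 ≤ k) (j : ZMod n) :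
    Li (k + 1) (zetaN n ^ j.val) = HurwitzZeta.expZeta (ZMod.toAddCircle j) ((k : ℂ) + 1) := by
  have hs : 1 < ((k : ℂ) + 1).re := by
    have : (1 : ℝ) ≤ k := by exact_mod_cast hk
    simp
    linarith
  have h := HurwitzZeta.hasSum_expZeta_of_one_lt_re ((j.val : ℝ) / n) hs
  rw [← ZMod.toAddCircle_apply] at h
  have h0 := (hasSum_nat_add_iff' 1).mpr h
  have hz : (0 : ℂ) ^ ((k : ℂ) + 1) = 0 := by
    rw [show ((k : ℂ) + 1) = ((k + 1 : ℕ) : ℂ) by push_cast; rfl, cpow_natCast]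
    simp
  simp only [Finset.sum_range_one, Nat.cast_zero, hz, div_zero, sub_zero] at h0
  rw [Li, ← h0.tsum_eq]
  refine tsum_congr fun m ↦ ?_
  rw [show ((k : ℂ) + 1) = ((k + 1 : ℕ) : ℂ) by push_cast; rfl, cpow_natCast, zetaN,
    ← Complex.exp_nat_mul, ← Complex.exp_nat_mul]
  push_cast
  congr 2
  ring

namespace DirichletCharacter

variable {N : ℕ} [NeZero N]

/-- The Gauss sum of a primitive Dirichlet character does not vanish. -/
lemma IsPrimitive.gaussSum_stdAddChar_ne_zero {χ : DirichletCharacter ℂ N} (hχ : χ.IsPrimitive) :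
    gaussSum χ ZMod.stdAddChar ≠ 0 := by
  intro h
  have h𝓕 : 𝓕 (χ : ZMod N → ℂ) = 0 := by
    ext k
    rw [hχ.fourierTransform_eq_inv_mul_gaussSum, h, mul_zero, Pi.zero_apply]
  have h1 := congrFun ((LinearEquiv.map_eq_zero_iff _).mp h𝓕) 1
  simp at h1

/-- For a primitive character, the L-function of the Fourier transform does not vanish in the
half-plane of absolute convergence. -/
lemma IsPrimitive.LFunction_dft_ne_zero {χ : DirichletCharacter ℂ N} (hχ : χ.IsPrimitive)
    {s : ℂ} (hs : 1 < s.re) : ZMod.LFunction (𝓕 (χ : ZMod N → ℂ)) s ≠ 0 := by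
  have h𝓕 : 𝓕 (χ : ZMod N → ℂ) =
      fun k ↦ (χ⁻¹ (-1) * gaussSum χ ZMod.stdAddChar) * χ⁻¹ k := by
    ext k
    rw [hχ.fourierTransform_eq_inv_mul_gaussSum, ← neg_one_mul k, map_mul]
    ring
  have hL : ZMod.LFunction (𝓕 (χ : ZMod N → ℂ)) s =
      χ⁻¹ (-1) * gaussSum χ ZMod.stdAddChar * LFunction χ⁻¹ s := by
    rw [h𝓕, LFunction]
    simp only [ZMod.LFunction, Finset.mul_sum]
    exact Finset.sum_congr rfl fun j _ ↦ by ring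
  rw [hL, LFunction_eq_LSeries _ hs]
  refine mul_ne_zero (mul_ne_zero ?_ hχ.gaussSum_stdAddChar_ne_zero)
    (LSeries_ne_zero_of_one_lt_re _ hs)
  exact ((isUnit_one.neg).map χ⁻¹).ne_zero

/-- Functional equation of a (not necessarily primitive) Dirichlet character, with the
archimedean factor depending on the character only through its parity. -/
lemma LFunction_one_sub_eq_dft (χ : DirichletCharacter ℂ N) {s : ℂ} (hs : s.im ≠ 0) :
    LFunction χ (1 - s) = (N : ℂ) ^ (s - 1) * ((2 * Real.pi) ^ (-s) * Gamma s *
      (cexp (Real.pi * I * s / 2) + χ (-1) * cexp (-Real.pi * I * s / 2))) *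
        ZMod.LFunction (𝓕 (χ : ZMod N → ℂ)) s := by
  have hneg : (fun x : ZMod N ↦ χ (-x)) = fun x ↦ χ (-1) * χ x := by
    ext x
    rw [← map_mul, neg_one_mul]
  have hL : ZMod.LFunction (𝓕 fun x : ZMod N ↦ χ (-x)) s =
      χ (-1) * ZMod.LFunction (𝓕 (χ : ZMod N → ℂ)) s := by
    rw [hneg, ZMod.dft_const_mul]
    simp only [ZMod.LFunction, Finset.mul_sum]
    exact Finset.sum_congr rfl fun j _ ↦ by ring
  rw [LFunction, ZMod.LFunction_one_sub (Φ := χ) (fun n h ↦ hs (by simp [h]))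
    (Or.inr fun h ↦ hs (by simp [h])), hL]
  ring

/-- The archimedean factor of the functional equation does not vanish off the real axis. -/
lemma archimedean_factor_ne_zero {N : ℕ} (χ : DirichletCharacter ℂ N) {s : ℂ} (hs : s.im ≠ 0) :
    (2 * Real.pi : ℂ) ^ (-s) * Gamma s *
      (cexp (Real.pi * I * s / 2) + χ (-1) * cexp (-Real.pi * I * s / 2)) ≠ 0 := by
  refine mul_ne_zero (mul_ne_zero ?_ ?_) fun h ↦ ?_
  · simp [cpow_eq_zero_iff, Real.pi_ne_zero]
  · exact Gamma_ne_zero fun m h ↦ hs (by simp [h])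
  · have hnorm := congrArg norm (eq_neg_of_add_eq_zero_left h)
    have hχ : ‖χ (-1)‖ = 1 := by
      rw [← Units.coe_neg_one]
      exact χ.unit_norm_eq_one _
    rw [norm_neg, norm_mul, hχ, one_mul, norm_exp, norm_exp, Real.exp_eq_exp] at hnorm
    simp at hnorm
    have h2 : Real.pi * s.im = 0 := by linarith
    exact (mul_ne_zero Real.pi_ne_zero hs) h2

/-- Comparison of the L-functions of the Fourier transforms of a Dirichlet character at two
levels. -/
lemma LFunction_dft_changeLevel {M : ℕ} [NeZero M] (hMN : M ∣ N) (χ : DirichletCharacter ℂ M)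
    {s : ℂ} (hs : s ≠ 1) :
    (N : ℂ) ^ (s - 1) * ZMod.LFunction (𝓕 (changeLevel hMN χ : ZMod N → ℂ)) s =
      (M : ℂ) ^ (s - 1) * ZMod.LFunction (𝓕 (χ : ZMod M → ℂ)) s *
        ∏ p ∈ N.primeFactors, (1 - χ p * (p : ℂ) ^ (s - 1)) := by
  have off_real {t : ℂ} (ht : t.im ≠ 0) :
      (N : ℂ) ^ (t - 1) * ZMod.LFunction (𝓕 (changeLevel hMN χ : ZMod N → ℂ)) t =
        (M : ℂ) ^ (t - 1) * ZMod.LFunction (𝓕 (χ : ZMod M → ℂ)) t *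
          ∏ p ∈ N.primeFactors, (1 - χ p * (p : ℂ) ^ (t - 1)) := by
    have hsign : changeLevel hMN χ (-1) = χ (-1) := by
      have := changeLevel_eq_cast_of_dvd χ hMN (-1)
      simpa [ZMod.cast_neg hMN, ZMod.cast_one hMN] using this
    have h := LFunction_changeLevel hMN χ (s := 1 - t)
      (Or.inr fun h ↦ ht (by simpa using congrArg im h))
    rw [LFunction_one_sub_eq_dft _ ht, LFunction_one_sub_eq_dft _ ht, hsign] at h
    simp only [neg_sub] at h
    refine mul_left_cancel₀ (archimedean_factor_ne_zero χ ht) ?_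
    linear_combination h
  have hpath : Tendsto (fun x : ℝ ↦ s + x * I) (𝓝[≠] (0 : ℝ)) (𝓝 s) := by
    have : ContinuousAt (fun x : ℝ ↦ s + x * I) 0 := by fun_prop
    simpa [ContinuousAt] using this.mono_left nhdsWithin_le_nhds
  have hcpow (m : ℕ) (hm : m ≠ 0) : ContinuousAt (fun t : ℂ ↦ (m : ℂ) ^ (t - 1)) s :=
    (continuousAt_id.sub continuousAt_const).const_cpow (Or.inl (Nat.cast_ne_zero.mpr hm))
  have hL {K : ℕ} [NeZero K] (Φ : ZMod K → ℂ) : ContinuousAt (ZMod.LFunction Φ) s :=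
    (ZMod.differentiableAt_LFunction Φ s (Or.inl hs)).continuousAt
  have hleft := ((hcpow N (NeZero.ne N)).mul
    (hL (𝓕 (changeLevel hMN χ : ZMod N → ℂ)))).tendsto.comp hpath
  have hright := (((hcpow M (NeZero.ne M)).mul (hL (𝓕 (χ : ZMod M → ℂ)))).mul
    (tendsto_finsetProd N.primeFactors fun p hp ↦ continuousAt_const.sub
      (continuousAt_const.mul (hcpow p (Nat.prime_of_mem_primeFactors hp).ne_zero)) :
      ContinuousAt (fun t : ℂ ↦ ∏ p ∈ N.primeFactors,
        (1 - χ p * (p : ℂ) ^ (t - 1))) s)).tendsto.comp hpath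
  refine tendsto_nhds_unique_of_eventuallyEq hleft hright ?_
  have him : ∀ᶠ x : ℝ in 𝓝[≠] 0, x ≠ -s.im := by
    by_cases h : s.im = 0
    · simpa [h] using eventually_mem_nhdsWithin (a := (0 : ℝ)) (s := {0}ᶜ)
    · exact (eventually_ne_nhds (by simpa [eq_comm] using h)).filter_mono nhdsWithin_le_nhds
  filter_upwards [him] with x hx
  exact off_real fun h ↦ hx (by simp at h; linarith)

/-- The L-function of the Fourier transform of any Dirichlet character does not vanish to the
right of `re s = 1`. -/
lemma LFunction_dft_ne_zero (χ : DirichletCharacter ℂ N) {s : ℂ} (hs : 1 < s.re) :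
    ZMod.LFunction (𝓕 (χ : ZMod N → ℂ)) s ≠ 0 := by
  have : NeZero χ.conductor := ⟨χ.conductor_ne_zero⟩
  have h := LFunction_dft_changeLevel χ.conductor_dvd_level χ.primitiveCharacter (s := s)
    (by rintro rfl; simp at hs)
  rw [changeLevel_primitiveCharacter] at h
  refine right_ne_zero_of_mul (a := (N : ℂ) ^ (s - 1)) ?_
  rw [h]
  refine mul_ne_zero (mul_ne_zero ?_ ?_) ?_
  · simp [cpow_eq_zero_iff, NeZero.ne]
  · exact χ.primitiveCharacter_isPrimitive.LFunction_dft_ne_zero hs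
  · refine Finset.prod_ne_zero_iff.mpr fun p hp h0 ↦ ?_
    have hp' := Nat.prime_of_mem_primeFactors hp
    have hnorm := congrArg norm (sub_eq_zero.mp h0)
    rw [norm_one, norm_mul, norm_natCast_cpow_of_pos hp'.pos] at hnorm
    have hpow : 1 < (p : ℝ) ^ (s - 1).re :=
      Real.one_lt_rpow (by exact_mod_cast hp'.one_lt) (by simpa using hs)
    by_cases hu : IsUnit (p : ZMod χ.conductor)
    · rw [← hu.unit_spec, unit_norm_eq_one, one_mul] at hnorm
      exact hpow.ne hnorm
    · rw [MulChar.map_nonunit _ hu] at hnorm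
      simp at hnorm

end DirichletCharacter

/-- For every `n ≥ 1`, `k ≥ 1` and every multiplicative character `χ` of `ℤ/n`,
the number `e_n(χ) = ∑_{a ∈ (ℤ/n)^*} Li_{k+1}(ζ_n^a) · conj(χ(a))` is nonzero. -/
theorem stmt2 (n k : ℕ) [NeZero n] (hk : 1 ≤ k) (χ : (ZMod n)ˣ →* ℂˣ) :
    (∑ a : (ZMod n)ˣ, Li (k + 1) (zetaN n ^ ((a : ZMod n).val)) *
      (starRingEnd ℂ) ((χ a : ℂˣ) : ℂ)) ≠ 0 := by
  have hs : 1 < ((k : ℂ) + 1).re := by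
    have : (1 : ℝ) ≤ k := by exact_mod_cast hk
    simp
    linarith
  let ψ : DirichletCharacter ℂ n := (MulChar.ofUnitHom χ).ringHomComp (starRingEnd ℂ)
  have hsum : ∑ a : (ZMod n)ˣ, Li (k + 1) (zetaN n ^ ((a : ZMod n).val)) *
      (starRingEnd ℂ) ((χ a : ℂˣ) : ℂ) =
      ∑ j : ZMod n, ψ j * HurwitzZeta.expZeta (ZMod.toAddCircle j) ((k : ℂ) + 1) := by
    refine Fintype.sum_of_injective Units.val Units.val_injective _ _ (fun j hj ↦ ?_) fun a ↦ ?_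
    · rw [MulChar.map_nonunit _ fun hu ↦ hj ⟨hu.unit, hu.unit_spec⟩, zero_mul]
    · rw [Li_zetaN_pow_val n k hk, mul_comm]
      simp [ψ]
  have hdft : ZMod.LFunction (𝓕 (ψ : ZMod n → ℂ)) ((k : ℂ) + 1) = ψ (-1) *
      ∑ j : ZMod n, ψ j * HurwitzZeta.expZeta (ZMod.toAddCircle j) ((k : ℂ) + 1) := by
    rw [ZMod.LFunction_dft _ (Or.inr fun h ↦ by simp [h] at hs), Finset.mul_sum]
    refine Fintype.sum_equiv (Equiv.neg _) _ _ fun j ↦ ?_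
    rw [Equiv.neg_apply, ← mul_assoc, ← map_mul, neg_one_mul, neg_neg]
  rw [hsum]
  exact right_ne_zero_of_mul (hdft ▸ ψ.LFunction_dft_ne_zero hs)
end

section
/- Let k ≥ 1, let p be a prime, let n' ≥ 1 with p | n', and set n = p·n'. Let χ' be a multiplicative character of ℤ/n' and let χ = χ' ∘ π be the character of ℤ/n obtained via the canonical reduction π : (ℤ/n)^* → (ℤ/n')^*. Then e_n(χ) = p^{-k} · e_{n'}(χ'). -/
/-- `e_n(χ) = ∑_{a ∈ (ℤ/n)^*} Li_{k+1}(ζ_n^a) · conj(χ(a))`. -/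
noncomputable def eSum (n k : ℕ) [NeZero n] (χ : (ZMod n)ˣ →* ℂˣ) : ℂ :=
  ∑ a : (ZMod n)ˣ, Li (k + 1) (zetaN n ^ ((a : ZMod n).val)) *
    (starRingEnd ℂ) ((χ a : ℂˣ) : ℂ)

/-- The polylogarithm series of order at least two converges absolutely on the closed unit disc. -/
lemma summable_polylog {k : ℕ} (hk : 1 ≤ k) {z : ℂ} (hz : ‖z‖ ≤ 1) :
    Summable fun m : ℕ => z ^ (m + 1) / ((m : ℂ) + 1) ^ (k + 1) := by
  have h : Summable fun m : ℕ => 1 / ((m + 1 : ℕ) : ℝ) ^ (k + 1) :=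
    (summable_nat_add_iff 1).2 (Real.summable_one_div_nat_pow.2 (by omega))
  refine Summable.of_norm_bounded h fun m => ?_
  have hm : ‖(m : ℂ) + 1‖ = ((m + 1 : ℕ) : ℝ) := by
    rw [← Nat.cast_succ, Complex.norm_natCast]
  rw [norm_div, norm_pow, norm_pow, hm]
  gcongr
  exact pow_le_one₀ (norm_nonneg _) hz

lemma IsPrimitiveRoot.sum_pow_mul_eq_ite {p : ℕ} {ω : ℂ} (hω : IsPrimitiveRoot ω p) (m : ℕ) :
    ∑ j ∈ Finset.range p, (ω ^ j) ^ m = if p ∣ m then (p : ℂ) else 0 := by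
  simp_rw [← pow_mul, mul_comm _ m, pow_mul]
  split_ifs with h
  · simp [(hω.pow_eq_one_iff_dvd m).2 h]
  · have h1 : ω ^ m ≠ 1 := fun h' => h ((hω.pow_eq_one_iff_dvd m).1 h')
    rw [geom_sum_eq h1, ← pow_mul, mul_comm, pow_mul, hω.pow_eq_one]
    simp

/-- The distribution relation for polylogarithms. -/
lemma sum_Li_mul_pow {k p : ℕ} (hk : 1 ≤ k) (hp : p ≠ 0) {ω z : ℂ} (hω : IsPrimitiveRoot ω p)
    (hz : ‖z‖ ≤ 1) :
    ∑ j ∈ Finset.range p, Li (k + 1) (z * ω ^ j) = ((p : ℂ) ^ k)⁻¹ * Li (k + 1) (z ^ p) := by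
  have hp0 : (p : ℂ) ≠ 0 := Nat.cast_ne_zero.2 hp
  have hsum : ∀ j ∈ Finset.range p,
      Summable fun m : ℕ => (z * ω ^ j) ^ (m + 1) / ((m : ℂ) + 1) ^ (k + 1) := fun j _ =>
    summable_polylog hk (by simpa [hω.norm'_eq_one hp] using hz)
  have hinj : Function.Injective fun l : ℕ => p * l + (p - 1) := fun a b hab =>
    Nat.eq_of_mul_eq_mul_left (Nat.pos_of_ne_zero hp) (Nat.add_right_cancel hab)
  simp_rw [Li]
  rw [← Summable.tsum_finsetSum hsum, ← tsum_mul_left]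
  have hterm : ∀ m : ℕ, ∑ j ∈ Finset.range p, (z * ω ^ j) ^ (m + 1) / ((m : ℂ) + 1) ^ (k + 1) =
      z ^ (m + 1) / ((m : ℂ) + 1) ^ (k + 1) * if p ∣ m + 1 then (p : ℂ) else 0 := fun m => by
    rw [← hω.sum_pow_mul_eq_ite, Finset.mul_sum]
    exact Finset.sum_congr rfl fun j _ => by ring
  simp_rw [hterm]
  rw [← hinj.tsum_eq]
  · refine tsum_congr fun l => ?_
    have hl : p * l + (p - 1) + 1 = p * (l + 1) := by
      rw [mul_add]; omega
    have hl' : ((p * l + (p - 1) : ℕ) : ℂ) + 1 = p * (l + 1) := by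
      exact_mod_cast hl
    have hl0 : (l : ℂ) + 1 ≠ 0 := Nat.cast_add_one_ne_zero l
    rw [hl', hl, if_pos (dvd_mul_right _ _), pow_mul, mul_pow (p : ℂ), pow_succ (p : ℂ)]
    field_simp
  · intro m hm
    have hd : p ∣ m + 1 := by
      by_contra h
      simp [h] at hm
    obtain ⟨_ | c, hc⟩ := hd
    · simp at hc
    · exact ⟨c, by rw [mul_add] at hc; simp only; omega⟩

/-- The units of `ZMod (p * n)` above a unit `b` of `ZMod n` are represented by
`b, b + n, …, b + (p - 1) * n` when `p` divides `n`. -/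
lemma sum_fiber_unitsMap {M : Type*} [AddCommMonoid M] {p n : ℕ} [NeZero (p * n)] [NeZero n]
    (hpn : p ∣ n) (b : (ZMod n)ˣ) (f : ℕ → M) :
    ∑ a : (ZMod (p * n))ˣ with ZMod.unitsMap (dvd_mul_left n p) a = b, f (a : ZMod (p * n)).val =
      ∑ j ∈ Finset.range p, f ((b : ZMod n).val + n * j) := by
  have hn : 0 < n := Nat.pos_of_ne_zero (NeZero.ne n)
  have hmod : ∀ a : (ZMod (p * n))ˣ, ZMod.unitsMap (dvd_mul_left n p) a = b →
      (a : ZMod (p * n)).val % n = (b : ZMod n).val := by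
    rintro a rfl
    rw [ZMod.unitsMap_val, ZMod.cast_eq_val, ZMod.val_natCast]
  have hrep : ∀ a : (ZMod (p * n))ˣ, ZMod.unitsMap (dvd_mul_left n p) a = b →
      (b : ZMod n).val + n * ((a : ZMod (p * n)).val / n) = (a : ZMod (p * n)).val := fun a ha => by
    rw [← hmod a ha, Nat.mod_add_div]
  refine Finset.sum_nbij (fun a => (a : ZMod (p * n)).val / n) ?_ ?_ ?_ ?_
  · intro a _
    exact Finset.mem_range.2 (Nat.div_lt_of_lt_mul (by
      rw [mul_comm n p]; exact ZMod.val_lt (a : ZMod (p * n))))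
  · intro a ha a' ha' h
    simp only [Finset.coe_filter, Finset.mem_univ, true_and, Set.mem_ofPred_eq] at ha ha' h
    refine Units.ext (ZMod.val_injective _ ?_)
    rw [← hrep a ha, ← hrep a' ha', h]
  · intro j hj
    have hj : j < p := by simpa using hj
    have hb : (b : ZMod n).val < n := ZMod.val_lt _
    have hco : ((b : ZMod n).val + n * j).Coprime n :=
      (Nat.coprime_add_mul_left_left _ _ _).2 (ZMod.val_coe_unit_coprime b)
    have hlt : (b : ZMod n).val + n * j < p * n := by
      nlinarith [Nat.mul_le_mul_left n (Nat.succ_le_of_lt hj)]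
    refine ⟨ZMod.unitOfCoprime _ (Nat.Coprime.mul_right (hco.coprime_dvd_right hpn) hco), ?_, ?_⟩
    · simp only [Finset.coe_filter, Finset.mem_univ, true_and, Set.mem_ofPred_eq]
      refine Units.ext ?_
      rw [ZMod.unitsMap_val, ZMod.coe_unitOfCoprime, ZMod.cast_natCast (dvd_mul_left n p)]
      simp
    · simp only [ZMod.coe_unitOfCoprime]
      rw [ZMod.val_natCast, Nat.mod_eq_of_lt hlt, Nat.add_mul_div_left _ _ hn,
        Nat.div_eq_of_lt hb, zero_add]
  · intro a ha
    rw [hrep a (by simpa using ha)]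

lemma isPrimitiveRoot_zetaN {n : ℕ} (hn : n ≠ 0) : IsPrimitiveRoot (zetaN n) n :=
  Complex.isPrimitiveRoot_exp n hn

lemma zetaN_mul_pow {p : ℕ} (hp : p ≠ 0) (n : ℕ) : zetaN (p * n) ^ p = zetaN n := by
  have hp0 : (p : ℂ) ≠ 0 := Nat.cast_ne_zero.2 hp
  rw [zetaN, zetaN, ← Complex.exp_nat_mul]
  congr 1
  push_cast
  rw [mul_div_assoc', mul_div_mul_left _ _ hp0]

/-- Let `k ≥ 1`, `p` prime, `n' ≥ 1` with `p ∣ n'`, and `n = p·n'`. If `χ'` is a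
character of `ℤ/n'` and `χ = χ' ∘ π` with `π : (ℤ/n)^* → (ℤ/n')^*` the canonical
reduction, then `e_n(χ) = p^{-k} · e_{n'}(χ')`. -/
theorem stmt9 (k p n' : ℕ) (hk : 1 ≤ k) (hp : p.Prime) [NeZero n'] (hpn' : p ∣ n')
    (χ' : (ZMod n')ˣ →* ℂˣ) :
    haveI : NeZero p := ⟨hp.ne_zero⟩
    eSum (p * n') k (χ'.comp (ZMod.unitsMap (dvd_mul_left n' p))) =
      ((p : ℂ) ^ k)⁻¹ * eSum n' k χ' := by
  have : NeZero p := ⟨hp.ne_zero⟩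
  have hζ : IsPrimitiveRoot (zetaN (p * n')) (p * n') := isPrimitiveRoot_zetaN (NeZero.ne _)
  have hω : IsPrimitiveRoot (zetaN (p * n') ^ n') p :=
    hζ.pow (Nat.pos_of_ne_zero (NeZero.ne _)) (mul_comm p n')
  simp only [eSum]
  rw [← Finset.sum_fiberwise Finset.univ (ZMod.unitsMap (dvd_mul_left n' p)), Finset.mul_sum]
  refine Finset.sum_congr rfl fun b _ => ?_
  rw [← mul_assoc, ← zetaN_mul_pow hp.ne_zero n', pow_right_comm,
    ← sum_Li_mul_pow hk hp.ne_zero hω (by simp [hζ.norm'_eq_one (NeZero.ne _)])]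
  simp_rw [← pow_mul, ← pow_add]
  rw [← sum_fiber_unitsMap hpn' b fun m => Li (k + 1) (zetaN (p * n') ^ m), Finset.sum_mul]
  refine Finset.sum_congr rfl fun a ha => ?_
  rw [MonoidHom.comp_apply, (Finset.mem_filter.1 ha).2]
end
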